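/- Outer bound for two sub-dealers (Corollary 2): assume D = 2. Every achievable rate pair (R_1, R_2) ∈ C(𝔸) satisfies: R_1 ≤ min_{A∈𝔸} min_{U∈𝕌} I(Y_1; X_A, Y_2 | X_U), R_2 ≤ min_{A∈𝔸} min_{U∈𝕌} I(Y_2; X_A, Y_1 | X_U), and R_1 + R_2 ≤ min_{A∈𝔸} min_{U∈𝕌} I(Y_𝒟; X_A | X_U). -/

import Mathlib

open scoped BigOperators
open Finset Filter

noncomputable section

namespace SecretSharing

open scoped Classical

/-! ### Basic Shannon information quantities (base 2) on finite probability spaces -/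

variable {Ω : Type*} [Fintype Ω]

/-- `p` is a probability mass function on the finite type `Ω`. -/
def IsPMF (p : Ω → ℝ) : Prop := (∀ ω, 0 ≤ p ω) ∧ ∑ ω : Ω, p ω = 1

/-- Probability that the random variable `X` takes the value `a` under `p`. -/
def prob (p : Ω → ℝ) {A : Type*} (X : Ω → A) (a : A) : ℝ :=
  ∑ ω : Ω, if X ω = a then p ω else 0

/-- Shannon entropy (in bits) of the random variable `X` under `p`. -/
def ent (p : Ω → ℝ) {A : Type*} [Fintype A] (X : Ω → A) : ℝ :=
  -∑ a : A, prob p X a * Real.logb 2 (prob p X a)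

/-- Conditional Shannon entropy `H(X | Y)` in bits. -/
def condEnt (p : Ω → ℝ) {A B : Type*} [Fintype A] [Fintype B]
    (X : Ω → A) (Y : Ω → B) : ℝ :=
  ent p (fun ω => (X ω, Y ω)) - ent p Y

/-- Mutual information `I(X ; Y)` in bits. -/
def mutInf (p : Ω → ℝ) {A B : Type*} [Fintype A] [Fintype B]
    (X : Ω → A) (Y : Ω → B) : ℝ :=
  ent p X + ent p Y - ent p (fun ω => (X ω, Y ω))

/-- Conditional mutual information `I(X ; Y | Z)` in bits. -/
def condMutInf (p : Ω → ℝ) {A B C : Type*} [Fintype A] [Fintype B] [Fintype C]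
    (X : Ω → A) (Y : Ω → B) (Z : Ω → C) : ℝ :=
  condEnt p X Z - condEnt p X (fun ω => (Y ω, Z ω))

/-! ### The distributed secret-sharing model -/

variable {L D : ℕ} {𝒳 : Fin L → Type} {𝒴 : Fin D → Type}
variable [∀ l, Fintype (𝒳 l)] [∀ d, Fintype (𝒴 d)]

/-- Sample space for one source symbol: the participants' observations and the
sub-dealers' observations. -/
abbrev Base (𝒳 : Fin L → Type) (𝒴 : Fin D → Type) : Type := (∀ l, 𝒳 l) × (∀ d, 𝒴 d)

/-- The i.i.d. product pmf of `p` over `n` source symbols. -/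
def iid (p : Base 𝒳 𝒴 → ℝ) (n : ℕ) : (Fin n → Base 𝒳 𝒴) → ℝ :=
  fun ω => ∏ i, p (ω i)

/-- Observations `X_T` of the set `T` of participants (single symbol). -/
def XT (T : Finset (Fin L)) : Base 𝒳 𝒴 → ∀ l : {l // l ∈ T}, 𝒳 l.1 :=
  fun ω l => ω.1 l.1

/-- Observations `Y_S` of the set `S` of sub-dealers (single symbol). -/
def YS (S : Finset (Fin D)) : Base 𝒳 𝒴 → ∀ d : {d // d ∈ S}, 𝒴 d.1 :=
  fun ω d => ω.2 d.1

/-- Observations `X_T^n` of the set `T` of participants over a block of length `n`. -/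
def XTn (T : Finset (Fin L)) (n : ℕ) :
    (Fin n → Base 𝒳 𝒴) → ∀ l : {l // l ∈ T}, Fin n → 𝒳 l.1 :=
  fun ω l i => (ω i).1 l.1

/-- Cardinality `⌈2^{n R_d}⌉` of the secret alphabet of sub-dealer `d`. -/
def secCard (R : Fin D → ℝ) (n : ℕ) (d : Fin D) : ℕ := ⌈(2:ℝ) ^ ((n : ℝ) * R d)⌉₊

/-- A secret-sharing strategy at blocklength `n` with rates `R`, for the access
structure `𝔸`: public messages, secrets, and decoders for authorized sets. -/
structure Strategy (𝒳 : Fin L → Type) (𝒴 : Fin D → Type)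
    (𝔸 : Set (Finset (Fin L))) (R : Fin D → ℝ) (n : ℕ) where
  msgCard : Fin D → ℕ
  encM : ∀ d : Fin D, (Fin n → 𝒴 d) → Fin (msgCard d)
  encS : ∀ d : Fin D, (Fin n → 𝒴 d) → Fin (secCard R n d)
  dec : ∀ A : Finset (Fin L), A ∈ 𝔸 →
    (∀ l : {l // l ∈ A}, Fin n → 𝒳 l.1) → (∀ d, Fin (msgCard d)) →
      ∀ d, Fin (secCard R n d)

variable {𝔸 : Set (Finset (Fin L))} {R : Fin D → ℝ} {n : ℕ}

/-- The public communication `M_𝒟` as a random variable. -/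
def Strategy.Mrv (σ : Strategy 𝒳 𝒴 𝔸 R n) :
    (Fin n → Base 𝒳 𝒴) → ∀ d, Fin (σ.msgCard d) :=
  fun ω d => σ.encM d (fun i => (ω i).2 d)

/-- The secrets `S_𝒟` as a random variable. -/
def Strategy.Srv (σ : Strategy 𝒳 𝒴 𝔸 R n) :
    (Fin n → Base 𝒳 𝒴) → ∀ d, Fin (secCard R n d) :=
  fun ω d => σ.encS d (fun i => (ω i).2 d)

/-- The estimate `Ŝ_𝒟(A)` computed by the authorized set `A`. -/
def Strategy.ShatRv (σ : Strategy 𝒳 𝒴 𝔸 R n) (A : Finset (Fin L)) (hA : A ∈ 𝔸) :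
    (Fin n → Base 𝒳 𝒴) → ∀ d, Fin (secCard R n d) :=
  fun ω => σ.dec A hA (fun l i => (ω i).1 l.1) (σ.Mrv ω)

/-- Error probability `P[Ŝ_𝒟(A) ≠ S_𝒟]`. -/
def Strategy.err (p : Base 𝒳 𝒴 → ℝ) (σ : Strategy 𝒳 𝒴 𝔸 R n)
    (A : Finset (Fin L)) (hA : A ∈ 𝔸) : ℝ :=
  ∑ ω : Fin n → Base 𝒳 𝒴, if σ.ShatRv A hA ω ≠ σ.Srv ω then iid p n ω else 0

/-- Information leakage `I(S_𝒟 ; M_𝒟, X_U^n)` to the set `U` of participants. -/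
def Strategy.leak (p : Base 𝒳 𝒴 → ℝ) (σ : Strategy 𝒳 𝒴 𝔸 R n)
    (U : Finset (Fin L)) : ℝ :=
  mutInf (iid p n) σ.Srv (fun ω => (σ.Mrv ω, XTn U n ω))

/-- Uniformity defect `log₂|𝒮_𝒟| - H(S_𝒟)`. -/
def Strategy.unif (p : Base 𝒳 𝒴 → ℝ) (σ : Strategy 𝒳 𝒴 𝔸 R n) : ℝ :=
  Real.logb 2 (∏ d, (secCard R n d : ℝ)) - ent (iid p n) σ.Srv

/-- Achievability of the rate tuple `R` for access structure `𝔸` and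
unauthorized sets `𝕌`: a sequence of strategies with vanishing error
probability (for every authorized set), vanishing leakage (for every
unauthorized set), and vanishing uniformity defect. -/
def Achievable (p : Base 𝒳 𝒴 → ℝ) (𝔸 𝕌 : Set (Finset (Fin L)))
    (R : Fin D → ℝ) : Prop :=
  (∀ d, 0 ≤ R d) ∧
  ∃ σ : (n : ℕ) → Strategy 𝒳 𝒴 𝔸 R n,
    (∀ A : Finset (Fin L), ∀ hA : A ∈ 𝔸,
      Tendsto (fun n => (σ n).err p A hA) atTop (nhds 0)) ∧
    (∀ U ∈ 𝕌, Tendsto (fun n => (σ n).leak p U) atTop (nhds 0)) ∧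
    Tendsto (fun n => (σ n).unif p) atTop (nhds 0)

/-- `𝔸` is a monotone access structure: nonempty, not containing `∅`, and
closed under taking supersets. -/
def MonotoneAccess (𝔸 : Set (Finset (Fin L))) : Prop :=
  𝔸.Nonempty ∧ ∅ ∉ 𝔸 ∧ ∀ A ∈ 𝔸, ∀ T : Finset (Fin L), A ⊆ T → T ∈ 𝔸

/-! ### Shannon toolbox -/

lemma sum_prob_mul (p : Ω → ℝ) {A : Type*} [Fintype A] (X : Ω → A) (g : A → ℝ) :
    ∑ a, prob p X a * g a = ∑ ω, p ω * g (X ω) := by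
  simp only [prob, Finset.sum_mul]
  rw [Finset.sum_comm]
  refine Finset.sum_congr rfl fun ω _ => ?_
  simp [ite_mul]

lemma ent_eq (p : Ω → ℝ) {A : Type*} [Fintype A] (X : Ω → A) :
    ent p X = -∑ ω, p ω * Real.logb 2 (prob p X (X ω)) := by
  unfold ent
  rw [sum_prob_mul p X (fun a => Real.logb 2 (prob p X a))]

lemma prob_nonneg {p : Ω → ℝ} (hp : IsPMF p) {A : Type*} (X : Ω → A) (a : A) :
    0 ≤ prob p X a := by
  unfold prob
  refine Finset.sum_nonneg fun ω _ => ?_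
  split_ifs
  · exact hp.1 ω
  · exact le_rfl

lemma le_prob {p : Ω → ℝ} (hp : IsPMF p) {A : Type*} (X : Ω → A) (ω : Ω) :
    p ω ≤ prob p X (X ω) := by
  unfold prob
  have := Finset.single_le_sum (f := fun ω' => if X ω' = X ω then p ω' else 0)
    (fun ω' _ => by
      split_ifs
      · exact hp.1 ω'
      · exact le_rfl) (Finset.mem_univ ω)
  simpa using this

/-- If `X` is a function of `Y` then `H(X) ≤ H(Y)`. -/
lemma ent_mono {p : Ω → ℝ} (hp : IsPMF p) {A B : Type*} [Fintype A] [Fintype B]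
    {X : Ω → A} {Y : Ω → B} (h : ∀ ω ω', Y ω = Y ω' → X ω = X ω') :
    ent p X ≤ ent p Y := by
  rw [ent_eq, ent_eq]
  refine neg_le_neg (Finset.sum_le_sum fun ω _ => ?_)
  rcases (hp.1 ω).eq_or_lt with h0 | h0
  · simp [← h0]
  · refine mul_le_mul_of_nonneg_left ?_ h0.le
    refine Real.logb_le_logb_of_le (by norm_num) (h0.trans_le (le_prob hp Y ω)) ?_
    unfold prob
    refine Finset.sum_le_sum fun ω' _ => ?_
    by_cases h1 : Y ω' = Y ω
    · simp [h1, h _ _ h1]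
    · simp only [h1, if_false]
      split_ifs
      · exact hp.1 ω'
      · exact le_rfl

lemma ent_congr {p : Ω → ℝ} (hp : IsPMF p) {A B : Type*} [Fintype A] [Fintype B]
    {X : Ω → A} {Y : Ω → B} (h : ∀ ω ω', Y ω = Y ω' ↔ X ω = X ω') :
    ent p X = ent p Y :=
  le_antisymm (ent_mono hp fun ω ω' => (h ω ω').1) (ent_mono hp fun ω ω' => (h ω ω').2)

/-- Gibbs inequality. -/
lemma gibbs {p : Ω → ℝ} (hp : IsPMF p) {A : Type*} [Fintype A] (X : Ω → A)
    (q : A → ℝ) (hq0 : ∀ a, 0 ≤ q a) (hq1 : ∑ a, q a ≤ 1)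
    (hpos : ∀ ω, 0 < p ω → 0 < q (X ω)) :
    ent p X ≤ -∑ ω, p ω * Real.logb 2 (q (X ω)) := by
  rw [ent_eq]
  have hl2 : 0 < Real.log 2 := Real.log_pos (by norm_num)
  have key : ∀ ω, p ω * Real.logb 2 (q (X ω)) - p ω * Real.logb 2 (prob p X (X ω))
      ≤ (p ω * (q (X ω) / prob p X (X ω)) - p ω) / Real.log 2 := by
    intro ω
    rcases (hp.1 ω).eq_or_lt with h0 | h0
    · simp [← h0]
    · have hP := h0.trans_le (le_prob hp X ω)
      have hQ := hpos ω h0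
      have h1 := Real.log_le_sub_one_of_pos (div_pos hQ hP)
      rw [Real.log_div hQ.ne' hP.ne'] at h1
      rw [le_div_iff₀ hl2]
      have e : (p ω * Real.logb 2 (q (X ω)) - p ω * Real.logb 2 (prob p X (X ω))) * Real.log 2
          = p ω * (Real.log (q (X ω)) - Real.log (prob p X (X ω))) := by
        unfold Real.logb
        field_simp
      rw [e]
      nlinarith [mul_le_mul_of_nonneg_left h1 h0.le]
  have hs := Finset.sum_le_sum fun ω (_ : ω ∈ Finset.univ) => key ω
  rw [← Finset.sum_div, Finset.sum_sub_distrib, Finset.sum_sub_distrib, hp.2,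
    ← sum_prob_mul p X (fun a => q a / prob p X a)] at hs
  have h2 : ∑ a, prob p X a * (q a / prob p X a) ≤ 1 := by
    refine le_trans (Finset.sum_le_sum fun a _ => ?_) hq1
    rcases (prob_nonneg hp X a).eq_or_lt with h0 | h0
    · rw [← h0]; simpa using hq0 a
    · rw [mul_div_cancel₀ _ h0.ne']
  have h3 : (∑ a, prob p X a * (q a / prob p X a) - 1) / Real.log 2 ≤ 0 :=
    div_nonpos_of_nonpos_of_nonneg (by linarith) hl2.le
  linarith

lemma sum_prob_pair (p : Ω → ℝ) {A B : Type*} [Fintype A] (X : Ω → A) (Z : Ω → B) (z : B) :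
    ∑ x, prob p (fun ω => (X ω, Z ω)) (x, z) = prob p Z z := by
  unfold prob
  rw [Finset.sum_comm]
  refine Finset.sum_congr rfl fun ω _ => ?_
  by_cases h : Z ω = z
  · simp [h, Prod.ext_iff]
  · simp [h, Prod.ext_iff]

lemma sum_prob {p : Ω → ℝ} (hp : IsPMF p) {A : Type*} [Fintype A] (X : Ω → A) :
    ∑ x, prob p X x = 1 := by
  have := sum_prob_mul p X (fun _ => 1)
  simpa [hp.2] using this

/-- Submodularity of entropy. -/
lemma ent_submod {p : Ω → ℝ} (hp : IsPMF p) {A B C : Type*} [Fintype A] [Fintype B] [Fintype C]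
    (X : Ω → A) (Y : Ω → B) (Z : Ω → C) :
    ent p (fun ω => (X ω, Y ω, Z ω)) + ent p Z
      ≤ ent p (fun ω => (X ω, Z ω)) + ent p (fun ω => (Y ω, Z ω)) := by
  have h := gibbs hp (fun ω => (X ω, Y ω, Z ω))
    (fun a => prob p (fun ω => (X ω, Z ω)) (a.1, a.2.2) *
      prob p (fun ω => (Y ω, Z ω)) (a.2.1, a.2.2) / prob p Z a.2.2)
    (fun a => div_nonneg (mul_nonneg (prob_nonneg hp _ _) (prob_nonneg hp _ _))
      (prob_nonneg hp _ _))
    (by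
      rw [Fintype.sum_prod_type]
      simp only [Fintype.sum_prod_type]
      have : ∀ x : A, ∑ y : B, ∑ z : C, prob p (fun ω => (X ω, Z ω)) (x, z) *
          prob p (fun ω => (Y ω, Z ω)) (y, z) / prob p Z z =
          ∑ z : C, prob p (fun ω => (X ω, Z ω)) (x, z) := by
        intro x
        rw [Finset.sum_comm]
        refine Finset.sum_congr rfl fun z _ => ?_
        rw [← Finset.sum_div, ← Finset.mul_sum, sum_prob_pair]
        by_cases h0 : prob p Z z = 0
        · have h1 := sum_prob_pair p X Z z
          rw [h0, Finset.sum_eq_zero_iff_of_nonneg (fun _ _ => prob_nonneg hp _ _)] at h1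
          rw [h1 x (Finset.mem_univ _)]; simp
        · rw [mul_div_cancel_right₀ _ h0]
      simp only [this]
      rw [Finset.sum_comm]
      simp only [sum_prob_pair]
      exact (sum_prob hp Z).le)
    (fun ω h0 => div_pos (mul_pos (h0.trans_le (le_prob hp (fun ω => (X ω, Z ω)) ω))
      (h0.trans_le (le_prob hp (fun ω => (Y ω, Z ω)) ω))) (h0.trans_le (le_prob hp Z ω)))
  have e : ∑ ω, p ω * Real.logb 2 (prob p (fun ω => (X ω, Z ω)) (X ω, Z ω) *
      prob p (fun ω => (Y ω, Z ω)) (Y ω, Z ω) / prob p Z (Z ω)) =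
      ∑ ω, p ω * Real.logb 2 (prob p (fun ω => (X ω, Z ω)) (X ω, Z ω))
      + ∑ ω, p ω * Real.logb 2 (prob p (fun ω => (Y ω, Z ω)) (Y ω, Z ω))
      - ∑ ω, p ω * Real.logb 2 (prob p Z (Z ω)) := by
    rw [← Finset.sum_add_distrib, ← Finset.sum_sub_distrib]
    refine Finset.sum_congr rfl fun ω _ => ?_
    rcases (hp.1 ω).eq_or_lt with h0 | h0
    · simp [← h0]
    · have h1 := h0.trans_le (le_prob hp (fun ω => (X ω, Z ω)) ω)
      have h2 := h0.trans_le (le_prob hp (fun ω => (Y ω, Z ω)) ω)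
      have h3 := h0.trans_le (le_prob hp Z ω)
      rw [Real.logb_div (mul_pos h1 h2).ne' h3.ne', Real.logb_mul h1.ne' h2.ne']
      ring
  rw [ent_eq p Z, ent_eq p (fun ω => (X ω, Z ω)), ent_eq p (fun ω => (Y ω, Z ω))]
  dsimp only at h
  rw [e] at h
  linarith

/-- A flexible form of submodularity: `P` is the join of `Q` and `R`, and `S` is common. -/
lemma ent_submod' {p : Ω → ℝ} (hp : IsPMF p) {A B C E : Type*} [Fintype A] [Fintype B]
    [Fintype C] [Fintype E]
    (P : Ω → A) (Q : Ω → B) (R : Ω → C) (S : Ω → E)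
    (hP : ∀ ω ω', Q ω = Q ω' → R ω = R ω' → P ω = P ω')
    (hSQ : ∀ ω ω', Q ω = Q ω' → S ω = S ω')
    (hSR : ∀ ω ω', R ω = R ω' → S ω = S ω') :
    ent p P + ent p S ≤ ent p Q + ent p R := by
  have h := ent_submod hp Q R S
  have h1 : ent p P ≤ ent p (fun ω => (Q ω, R ω, S ω)) := ent_mono hp fun ω ω' h => by
    simp only [Prod.mk.injEq] at h
    exact hP _ _ h.1 h.2.1
  have h2 : ent p (fun ω => (Q ω, S ω)) ≤ ent p Q := ent_mono hp fun ω ω' h => by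
    rw [h, hSQ _ _ h]
  have h3 : ent p (fun ω => (R ω, S ω)) ≤ ent p R := ent_mono hp fun ω ω' h => by
    rw [h, hSR _ _ h]
  linarith

lemma ent_const {p : Ω → ℝ} (hp : IsPMF p) : ent p (fun _ => ()) = 0 := by
  rw [ent_eq]
  simp [prob, hp.2]

lemma ent_le_card {p : Ω → ℝ} (hp : IsPMF p) {A : Type*} [Fintype A] (X : Ω → A) (c : ℝ)
    (hc : 0 < c) (hA : (Fintype.card A : ℝ) ≤ c) : ent p X ≤ Real.logb 2 c := by
  have h := gibbs hp X (fun _ => c⁻¹) (fun _ => by positivity)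
    (by
      simp only [Finset.sum_const, Finset.card_univ, nsmul_eq_mul]
      rw [← div_eq_mul_inv, div_le_one hc]; exact hA)
    (fun _ _ => by positivity)
  rw [← Finset.sum_mul, hp.2, Real.logb_inv] at h
  linarith

/-- Fano inequality. -/
lemma fano {p : Ω → ℝ} (hp : IsPMF p) {A : Type*} [Fintype A] (S T : Ω → A) (c : ℝ)
    (hc : 0 < c) (hA : (Fintype.card A : ℝ) ≤ c) :
    ent p (fun ω => (S ω, T ω)) - ent p T
      ≤ 1 + (∑ ω, if T ω ≠ S ω then p ω else 0) * Real.logb 2 c := by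
  have h := gibbs hp (fun ω => (S ω, T ω))
    (fun a => prob p T a.2 * (if a.2 ≠ a.1 then 2⁻¹ * c⁻¹ else 2⁻¹))
    (fun a => mul_nonneg (prob_nonneg hp _ _) (by split_ifs <;> positivity))
    (by
      rw [Fintype.sum_prod_type, Finset.sum_comm]
      have : ∀ t : A, ∑ s : A, prob p T t * (if t ≠ s then 2⁻¹ * c⁻¹ else 2⁻¹)
          ≤ prob p T t := by
        intro t
        rw [← Finset.mul_sum]
        refine mul_le_of_le_one_right (prob_nonneg hp _ _) ?_
        have h1 : ∑ s : A, (if t ≠ s then 2⁻¹ * c⁻¹ else (2⁻¹ : ℝ)) ≤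
            ∑ s : A, (2⁻¹ * c⁻¹ + if t = s then (2⁻¹ : ℝ) else 0) := by
          refine Finset.sum_le_sum fun s _ => ?_
          have : 0 < 2⁻¹ * c⁻¹ := by positivity
          by_cases hts : t = s
          · simp only [hts, ne_eq, not_true_eq_false, if_false, if_true]; linarith
          · simp [hts]
        rw [Finset.sum_add_distrib] at h1
        simp only [Finset.sum_const, Finset.card_univ, nsmul_eq_mul, Finset.sum_ite_eq,
          Finset.mem_univ, if_true] at h1
        have h2 : (Fintype.card A : ℝ) * (2⁻¹ * c⁻¹) ≤ 2⁻¹ := by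
          have : (Fintype.card A : ℝ) * c⁻¹ ≤ 1 := by
            rw [← div_eq_mul_inv, div_le_one hc]; exact hA
          linarith
        linarith
      exact (Finset.sum_le_sum fun t _ => this t).trans (sum_prob hp T).le)
    (fun ω h0 => mul_pos (h0.trans_le (le_prob hp T ω)) (by
      split_ifs <;> positivity))
  have e : ∑ ω, p ω * Real.logb 2 (prob p T (T ω) * (if T ω ≠ S ω then 2⁻¹ * c⁻¹ else 2⁻¹)) =
      ∑ ω, p ω * Real.logb 2 (prob p T (T ω)) - ∑ ω, p ω
        - (∑ ω, if T ω ≠ S ω then p ω else 0) * Real.logb 2 c := by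
    rw [Finset.sum_mul, ← Finset.sum_sub_distrib, ← Finset.sum_sub_distrib]
    refine Finset.sum_congr rfl fun ω _ => ?_
    have l2 : Real.logb 2 2 = 1 := Real.logb_self_eq_one (by norm_num)
    rcases (hp.1 ω).eq_or_lt with h0 | h0
    · simp [← h0]
    · have h1 := h0.trans_le (le_prob hp T ω)
      split_ifs
      · rw [Real.logb_mul h1.ne' (by positivity), Real.logb_mul (by norm_num) (by positivity),
          Real.logb_inv, Real.logb_inv, l2]
        ring
      · rw [Real.logb_mul h1.ne' (by norm_num), Real.logb_inv, l2]
        ring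
  dsimp only at h
  rw [e, hp.2] at h
  rw [ent_eq p T]
  linarith

/-- The converse core, one block. -/
lemma core {q : Ω → ℝ} (hq : IsPMF q) {A B C E F G K : Type*} [Fintype A] [Fintype B]
    [Fintype C] [Fintype E] [Fintype F] [Fintype G] [Fintype K]
    (S Shat : Ω → A) (T : Ω → B) (N : Ω → C) (W : Ω → E) (V : Ω → F) (Z : Ω → G) (M : Ω → K)
    (hTS : ∀ ω ω', S ω = S ω' → T ω = T ω')
    (hTW : ∀ ω ω', W ω = W ω' → T ω = T ω')
    (hNW : ∀ ω ω', W ω = W ω' → N ω = N ω')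
    (hNM : ∀ ω ω', M ω = M ω' → N ω = N ω')
    (hSh : ∀ ω ω', V ω = V ω' → N ω = N ω' → Shat ω = Shat ω')
    (c : ℝ) (hc : 0 < c) (hA : (Fintype.card A : ℝ) ≤ c)
    (e : ℝ) (he : (∑ ω, if Shat ω ≠ S ω then q ω else 0) = e) :
    ent q T ≤ mutInf q S (fun ω => (M ω, Z ω)) +
      (1 + e * Real.logb 2 c) + condMutInf q W V Z := by
  have hf := fano hq S Shat c hc hA
  rw [he] at hf
  unfold mutInf condMutInf condEnt
  -- secrecy of `T`
  have h1 := ent_submod' hq (fun ω => (S ω, M ω, Z ω)) S (fun ω => (T ω, M ω, Z ω)) T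
    (by grind) (by grind) (by grind)
  -- drop the other message from the conditioning
  have h2 := ent_submod' hq (fun ω => (T ω, M ω, Z ω)) (fun ω => (M ω, Z ω))
    (fun ω => (T ω, N ω, Z ω)) (fun ω => (N ω, Z ω))
    (by grind) (by grind) (by grind)
  -- Fano side
  have h3 := ent_submod' hq (fun ω => (S ω, V ω, N ω, Z ω)) (fun ω => (S ω, Shat ω))
    (fun ω => (V ω, N ω, Z ω)) Shat
    (by grind) (by grind) (by grind)
  have h4 := ent_submod' hq (fun ω => (S ω, V ω, N ω, Z ω)) (fun ω => (S ω, V ω, N ω, Z ω))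
    (fun ω => (T ω, V ω, N ω, Z ω)) (fun ω => (T ω, V ω, N ω, Z ω))
    (by grind) (by grind) (by grind)
  -- data processing
  have h5 := ent_submod' hq (fun ω => (W ω, V ω, Z ω)) (fun ω => (W ω, Z ω))
    (fun ω => (T ω, V ω, N ω, Z ω)) (fun ω => (T ω, N ω, Z ω))
    (by grind) (by grind) (by grind)
  have h6 := ent_submod' hq (fun ω => (V ω, N ω, Z ω)) (fun ω => (N ω, Z ω))
    (fun ω => (V ω, Z ω)) Z
    (by grind) (by grind) (by grind)
  have h7 : ent q (fun ω => (T ω, V ω, N ω, Z ω)) ≤ ent q (fun ω => (S ω, V ω, N ω, Z ω)) :=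
    ent_mono hq (by grind)
  linarith

/-! ### i.i.d. blocks -/

lemma sum_iid_mul {p : Base 𝒳 𝒴 → ℝ} (hp : IsPMF p) (n : ℕ) (j : Fin n) (g : Base 𝒳 𝒴 → ℝ) :
    ∑ ω : Fin n → Base 𝒳 𝒴, iid p n ω * g (ω j) = ∑ b, p b * g b := by
  have h1 : ∀ ω : Fin n → Base 𝒳 𝒴, iid p n ω * g (ω j) =
      ∏ i, (p (ω i) * if i = j then g (ω i) else 1) := by
    intro ω
    rw [Finset.prod_mul_distrib]
    simp [iid]
  simp only [h1]
  have h2 := (Fintype.prod_sum (fun (i : Fin n) (b : Base 𝒳 𝒴) => p b * if i = j then g b else 1))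
  have h3 : ∀ i : Fin n, (∑ b : Base 𝒳 𝒴, p b * if i = j then g b else 1) =
      if i = j then ∑ b, p b * g b else 1 := by
    intro i
    split_ifs
    · rfl
    · simpa using hp.2
  simp only [h3, Finset.prod_ite_eq', Finset.mem_univ, if_true] at h2
  rw [h2]

lemma iid_isPMF {p : Base 𝒳 𝒴 → ℝ} (hp : IsPMF p) (n : ℕ) : IsPMF (iid p n) := by
  refine ⟨fun ω => Finset.prod_nonneg fun i _ => hp.1 _, ?_⟩
  have h2 := (Fintype.prod_sum (fun (_ : Fin n) (b : Base 𝒳 𝒴) => p b))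
  simp only [hp.2, Finset.prod_const_one] at h2
  rw [h2]
  refine Finset.sum_congr ?_ fun _ _ => rfl
  ext; simp

lemma prob_iid (p : Base 𝒳 𝒴 → ℝ) (n : ℕ) {A : Type*} (X : Base 𝒳 𝒴 → A) (x : Fin n → A) :
    prob (iid p n) (fun ω i => X (ω i)) x = ∏ i, prob p X (x i) := by
  unfold prob
  rw [Fintype.prod_sum]
  refine Finset.sum_congr ?_ fun ω _ => ?_
  · ext; simp
  · by_cases h : (fun i => X (ω i)) = x
    · subst h; simp [iid]
    · rw [if_neg h]
      obtain ⟨i, hi⟩ := Function.ne_iff.1 h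
      exact (Finset.prod_eq_zero (Finset.mem_univ i) (by simp [hi])).symm

lemma ent_iid {p : Base 𝒳 𝒴 → ℝ} (hp : IsPMF p) (n : ℕ) {A : Type*} [Fintype A]
    (X : Base 𝒳 𝒴 → A) :
    ent (iid p n) (fun ω i => X (ω i)) = n * ent p X := by
  rw [ent_eq, ent_eq]
  have h1 : ∀ ω : Fin n → Base 𝒳 𝒴, iid p n ω *
      Real.logb 2 (prob (iid p n) (fun ω i => X (ω i)) (fun i => X (ω i))) =
      ∑ j, iid p n ω * Real.logb 2 (prob p X (X (ω j))) := by
    intro ω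
    rw [prob_iid]
    by_cases h0 : ∃ i, p (ω i) = 0
    · obtain ⟨i, hi⟩ := h0
      have : iid p n ω = 0 := Finset.prod_eq_zero (Finset.mem_univ i) hi
      simp [this]
    · push Not at h0
      rw [Real.logb_prod, Finset.mul_sum]
      intro i _
      exact (((hp.1 (ω i)).lt_of_ne (h0 i).symm).trans_le (le_prob hp X (ω i))).ne'
  simp only [h1]
  rw [Finset.sum_comm]
  simp only [sum_iid_mul hp n _ (fun b => Real.logb 2 (prob p X (X b)))]
  simp

lemma condMutInf_iid {p : Base 𝒳 𝒴 → ℝ} (hp : IsPMF p) (n : ℕ) {A B C : Type*} [Fintype A]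
    [Fintype B] [Fintype C] (X : Base 𝒳 𝒴 → A) (Y : Base 𝒳 𝒴 → B) (Z : Base 𝒳 𝒴 → C)
    {C' : Type*} [Fintype C'] (Zn : (Fin n → Base 𝒳 𝒴) → C')
    (hZ : ∀ ω ω', Zn ω = Zn ω' ↔ (fun i => Z (ω i)) = (fun i => Z (ω' i))) :
    condMutInf (iid p n) (fun ω i => X (ω i)) (fun ω i => Y (ω i)) Zn
      = n * condMutInf p X Y Z := by
  have hq := iid_isPMF hp n
  unfold condMutInf condEnt
  rw [mul_sub, mul_sub, mul_sub, ← ent_iid hp, ← ent_iid hp, ← ent_iid hp, ← ent_iid hp]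
  congr 1
  · congr 1
    · exact ent_congr hq fun ω ω' => by
        simp only [Prod.mk.injEq, hZ, funext_iff, forall_and]
    · exact ent_congr hq fun ω ω' => (hZ ω ω').symm
  · congr 1
    · exact ent_congr hq fun ω ω' => by
        simp only [Prod.mk.injEq, hZ, funext_iff, forall_and]
    · exact ent_congr hq fun ω ω' => by
        simp only [Prod.mk.injEq, hZ, funext_iff, forall_and]

lemma XTn_iff (U : Finset (Fin L)) (n : ℕ) (ω ω' : Fin n → Base 𝒳 𝒴) :
    XTn U n ω = XTn U n ω' ↔ (fun i => XT U (ω i)) = (fun i => XT U (ω' i)) := by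
  simp only [XTn, XT, funext_iff]
  exact ⟨fun h i l => h l i, fun h l i => h i l⟩

lemma secCard_ge (R : Fin D → ℝ) (n : ℕ) (d : Fin D) :
    n * R d ≤ Real.logb 2 (secCard R n d) := by
  have h : (2:ℝ) ^ ((n : ℝ) * R d) ≤ secCard R n d := Nat.le_ceil _
  rw [Real.le_logb_iff_rpow_le (by norm_num)]
  · exact h
  · exact lt_of_lt_of_le (by positivity) h

lemma secCard_pos (R : Fin D → ℝ) (n : ℕ) (d : Fin D) : (0 : ℝ) < secCard R n d :=
  lt_of_lt_of_le (by positivity) (Nat.le_ceil ((2:ℝ) ^ ((n : ℝ) * R d)))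

lemma secCard_le (R : Fin D → ℝ) (n : ℕ) (d : Fin D) (hR : 0 ≤ R d) :
    Real.logb 2 (secCard R n d) ≤ n * R d + 1 := by
  rw [Real.logb_le_iff_le_rpow (by norm_num) (secCard_pos R n d), Real.rpow_add (by norm_num),
    Real.rpow_one]
  have h1 : (1:ℝ) ≤ 2 ^ ((n : ℝ) * R d) := Real.one_le_rpow (by norm_num) (by positivity)
  have h2 := Nat.ceil_lt_add_one (a := (2:ℝ) ^ ((n : ℝ) * R d)) (by positivity)
  unfold secCard
  linarith

/-- Passing to the limit. -/
lemma limit_step (r I c : ℝ) (u l e : ℕ → ℝ) (hu : Tendsto u atTop (nhds 0))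
    (hl : Tendsto l atTop (nhds 0)) (he : Tendsto e atTop (nhds 0))
    (h : ∀ n : ℕ, n * r ≤ u n + (l n + (1 + e n * (n * c + 2)) + n * I)) : r ≤ I := by
  have hinv : Tendsto (fun n : ℕ => ((n : ℝ))⁻¹) atTop (nhds 0) :=
    tendsto_inv_atTop_nhds_zero_nat
  have ht : Tendsto (fun n : ℕ => (u n + l n + 1 + e n * 2) * ((n : ℝ))⁻¹ + e n * c) atTop
      (nhds ((0 + 0 + 1 + 0 * 2) * 0 + 0 * c)) :=
    ((((hu.add hl).add_const 1).add (he.mul_const 2)).mul hinv).add (he.mul_const c)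
  have hle : r - I ≤ (0 + 0 + 1 + 0 * 2) * 0 + 0 * c := by
    refine ge_of_tendsto ht ?_
    filter_upwards [eventually_gt_atTop 0] with n hn
    have hn' : (0 : ℝ) < n := by exact_mod_cast hn
    have := h n
    have h3 : (r - I) * n ≤ ((u n + l n + 1 + e n * 2) * ((n : ℝ))⁻¹ + e n * c) * n := by
      have : ((u n + l n + 1 + e n * 2) * ((n : ℝ))⁻¹ + e n * c) * n =
        (u n + l n + 1 + e n * 2) + e n * c * n := by
        field_simp
      rw [this]; linarith
    exact le_of_mul_le_mul_right h3 hn'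
  linarith

/-- One-block bound for two dealers, single-dealer version. -/
lemma block_single {L : ℕ} {𝒳 : Fin L → Type} {𝒴 : Fin 2 → Type}
    [∀ l, Fintype (𝒳 l)] [∀ d, Fintype (𝒴 d)]
    {p : Base 𝒳 𝒴 → ℝ} (hp : IsPMF p) {𝔸 : Set (Finset (Fin L))} {R : Fin 2 → ℝ}
    (hR : ∀ d, 0 ≤ R d) {n : ℕ} (σ : Strategy 𝒳 𝒴 𝔸 R n) (A : Finset (Fin L)) (hA : A ∈ 𝔸)
    (U : Finset (Fin L)) (a b : Fin 2) (hab : ∀ d, d = a ∨ d = b) (hne : a ≠ b) :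
    n * R a ≤ σ.unif p + (σ.leak p U + (1 + σ.err p A hA * (n * (R a + R b) + 2)) +
      n * condMutInf p (fun ω => ω.2 a) (fun ω => (XT A ω, ω.2 b)) (XT U)) := by
  have hq := iid_isPMF hp n
  have huniv : (Finset.univ : Finset (Fin 2)) = {a, b} := by
    ext d; simpa using hab d
  have hprod : ∏ d, (secCard R n d : ℝ) = secCard R n a * secCard R n b := by
    rw [huniv, Finset.prod_pair hne]
  have hcpos : 0 < ∏ d, (secCard R n d : ℝ) := Finset.prod_pos fun d _ => secCard_pos R n d
  have hlog : Real.logb 2 (∏ d, (secCard R n d : ℝ)) =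
      Real.logb 2 (secCard R n a) + Real.logb 2 (secCard R n b) := by
    rw [hprod, Real.logb_mul (secCard_pos R n a).ne' (secCard_pos R n b).ne']
  have hcard : (Fintype.card (∀ d, Fin (secCard R n d)) : ℝ) ≤ ∏ d, (secCard R n d : ℝ) := by
    simp
  have hc := core hq σ.Srv (σ.ShatRv A hA) (fun ω => σ.Srv ω a) (fun ω => σ.Mrv ω a)
    (fun ω i => (ω i).2 a) (fun ω i => (XT A (ω i), (ω i).2 b)) (XTn U n) σ.Mrv
    (fun ω ω' h => by simp only [h])
    (fun ω ω' h => by simp only [Strategy.Srv, h])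
    (fun ω ω' h => by simp only [Strategy.Mrv, h])
    (fun ω ω' h => by simp only [h])
    (fun ω ω' h1 h2 => by
      simp only [funext_iff, Prod.mk.injEq, forall_and] at h1
      obtain ⟨h1, h3⟩ := h1
      have hM : σ.Mrv ω = σ.Mrv ω' := by
        funext d
        rcases hab d with rfl | rfl
        · exact h2
        · have : (fun i => (ω i).2 d) = (fun i => (ω' i).2 d) := funext h3
          simp only [Strategy.Mrv, this]
      have hX : (fun (l : {l // l ∈ A}) i => (ω i).1 l.1) = (fun (l : {l // l ∈ A}) i => (ω' i).1 l.1) := by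
        funext l i
        exact h1 i l
      simp only [Strategy.ShatRv, hM, hX])
    _ hcpos hcard (σ.err p A hA) (by
      unfold Strategy.err
      refine Finset.sum_congr rfl fun ω _ => ?_
      congr)
  rw [condMutInf_iid hp n (fun ω => ω.2 a) (fun ω => (XT A ω, ω.2 b)) (XT U) (XTn U n)
    (XTn_iff U n)] at hc
  -- uniformity
  have hu : ent (iid p n) σ.Srv + ent (iid p n) (fun _ => ()) ≤
      ent (iid p n) (fun ω => σ.Srv ω a) + ent (iid p n) (fun ω => σ.Srv ω b) :=
    ent_submod' hq _ _ _ _ (fun ω ω' h1 h2 => by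
      funext d
      rcases hab d with rfl | rfl
      · exact h1
      · exact h2) (fun _ _ _ => rfl) (fun _ _ _ => rfl)
  rw [ent_const hq] at hu
  have hb : ent (iid p n) (fun ω => σ.Srv ω b) ≤ Real.logb 2 (secCard R n b) :=
    ent_le_card hq _ _ (secCard_pos R n b) (by simp)
  have he : 0 ≤ σ.err p A hA := Finset.sum_nonneg fun ω _ => by
    split_ifs
    · exact hq.1 ω
    · exact le_rfl
  have h1 : σ.err p A hA * Real.logb 2 (∏ d, (secCard R n d : ℝ)) ≤
      σ.err p A hA * (n * (R a + R b) + 2) := by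
    refine mul_le_mul_of_nonneg_left ?_ he
    rw [hlog]
    have := secCard_le R n a (hR a)
    have := secCard_le R n b (hR b)
    linarith
  have h2 := secCard_ge R n a
  have hL : mutInf (iid p n) σ.Srv (fun ω => (σ.Mrv ω, XTn U n ω)) = σ.leak p U := rfl
  rw [hL] at hc
  unfold Strategy.unif
  linarith

/-- One-block bound for two dealers, sum-rate version. -/
lemma block_sum {L : ℕ} {𝒳 : Fin L → Type} {𝒴 : Fin 2 → Type}
    [∀ l, Fintype (𝒳 l)] [∀ d, Fintype (𝒴 d)]
    {p : Base 𝒳 𝒴 → ℝ} (hp : IsPMF p) {𝔸 : Set (Finset (Fin L))} {R : Fin 2 → ℝ}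
    (hR : ∀ d, 0 ≤ R d) {n : ℕ} (σ : Strategy 𝒳 𝒴 𝔸 R n) (A : Finset (Fin L)) (hA : A ∈ 𝔸)
    (U : Finset (Fin L)) :
    n * (R 0 + R 1) ≤ σ.unif p + (σ.leak p U + (1 + σ.err p A hA * (n * (R 0 + R 1) + 2)) +
      n * condMutInf p (fun ω => ω.2) (XT A) (XT U)) := by
  have hq := iid_isPMF hp n
  have hcpos : 0 < ∏ d, (secCard R n d : ℝ) := Finset.prod_pos fun d _ => secCard_pos R n d
  have hlog : Real.logb 2 (∏ d, (secCard R n d : ℝ)) =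
      Real.logb 2 (secCard R n 0) + Real.logb 2 (secCard R n 1) := by
    rw [Fin.prod_univ_two, Real.logb_mul (secCard_pos R n 0).ne' (secCard_pos R n 1).ne']
  have hcard : (Fintype.card (∀ d, Fin (secCard R n d)) : ℝ) ≤ ∏ d, (secCard R n d : ℝ) := by
    simp
  have hc := core hq σ.Srv (σ.ShatRv A hA) σ.Srv σ.Mrv
    (fun ω i => (ω i).2) (fun ω i => XT A (ω i)) (XTn U n) σ.Mrv
    (fun ω ω' h => h)
    (fun ω ω' h => by
      have h' : ∀ i, (ω i).2 = (ω' i).2 := fun i => congrFun h i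
      unfold Strategy.Srv
      funext d
      congr 1
      funext i
      rw [h' i])
    (fun ω ω' h => by
      have h' : ∀ i, (ω i).2 = (ω' i).2 := fun i => congrFun h i
      unfold Strategy.Mrv
      funext d
      congr 1
      funext i
      rw [h' i])
    (fun ω ω' h => h)
    (fun ω ω' h1 hM => by
      have hX : (fun (l : {l // l ∈ A}) i => (ω i).1 l.1) = (fun (l : {l // l ∈ A}) i => (ω' i).1 l.1) := by
        funext l i
        exact congrFun (congrFun h1 i) l
      simp only [Strategy.ShatRv, hM, hX])
    _ hcpos hcard (σ.err p A hA) (by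
      unfold Strategy.err
      refine Finset.sum_congr rfl fun ω _ => ?_
      congr)
  rw [condMutInf_iid hp n (fun ω => ω.2) (XT A) (XT U) (XTn U n) (XTn_iff U n)] at hc
  have he : 0 ≤ σ.err p A hA := Finset.sum_nonneg fun ω _ => by
    split_ifs
    · exact hq.1 ω
    · exact le_rfl
  have h1 : σ.err p A hA * Real.logb 2 (∏ d, (secCard R n d : ℝ)) ≤
      σ.err p A hA * (n * (R 0 + R 1) + 2) := by
    refine mul_le_mul_of_nonneg_left ?_ he
    rw [hlog]
    have := secCard_le R n 0 (hR 0)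
    have := secCard_le R n 1 (hR 1)
    linarith
  have h2 := secCard_ge R n 0
  have h3 := secCard_ge R n 1
  have hL : mutInf (iid p n) σ.Srv (fun ω => (σ.Mrv ω, XTn U n ω)) = σ.leak p U := rfl
  rw [hL] at hc
  unfold Strategy.unif
  linarith

/-- **Corollary 2 (Outer bound for two sub-dealers).** -/
theorem outer_bound_two_dealers
    {L : ℕ} (hL : 1 ≤ L)
    {𝒳 : Fin L → Type} {𝒴 : Fin 2 → Type}
    [∀ l, Fintype (𝒳 l)] [∀ l, Nonempty (𝒳 l)]
    [∀ d, Fintype (𝒴 d)] [∀ d, Nonempty (𝒴 d)]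
    (p : Base 𝒳 𝒴 → ℝ) (hp : IsPMF p)
    (𝔸 : Set (Finset (Fin L))) (h𝔸 : MonotoneAccess 𝔸)
    (R : Fin 2 → ℝ) (hach : Achievable p 𝔸 𝔸ᶜ R) :
    ∀ A ∈ 𝔸, ∀ U : Finset (Fin L), U ∉ 𝔸 →
      R 0 ≤ condMutInf p (fun ω => ω.2 0) (fun ω => (XT A ω, ω.2 1)) (XT U) ∧
      R 1 ≤ condMutInf p (fun ω => ω.2 1) (fun ω => (XT A ω, ω.2 0)) (XT U) ∧
      R 0 + R 1 ≤ condMutInf p (fun ω => ω.2) (XT A) (XT U) := by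
  intro A hA U hU
  obtain ⟨hR, σ, herr, hleak, hunif⟩ := hach
  refine ⟨?_, ?_, ?_⟩
  · exact limit_step _ _ _ _ _ _ hunif (hleak U hU) (herr A hA)
      fun n => block_single hp hR (σ n) A hA U 0 1 (by decide) (by decide)
  · exact limit_step _ _ _ _ _ _ hunif (hleak U hU) (herr A hA)
      fun n => block_single hp hR (σ n) A hA U 1 0 (by decide) (by decide)
  · exact limit_step _ _ _ _ _ _ hunif (hleak U hU) (herr A hA)
      fun n => block_sum hp hR (σ n) A hA U

end SecretSharing
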